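/- Let n ≥ 1 and j ∈ {1,…,n}. There exist constants C > 0 and c > 0 such that for all x, y ∈ ℝⁿ with x ≠ y, (∫_0^∞ Ω_j(x,y,t)² dt/t)^{1/2} ≤ C e^{-c(|x-y|² + |y| |x-y|)} / |x-y|^n. -/

import Mathlib

open Real MeasureTheory Set

/-- The Mehler (Hermite heat) kernel on ℝⁿ. -/
noncomputable def W (n : ℕ) (s : ℝ) (x y : EuclideanSpace ℝ (Fin n)) : ℝ :=
  (Real.exp (-2 * s) / (Real.pi * (1 - Real.exp (-4 * s)))) ^ ((n : ℝ) / 2) *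
    Real.exp (-(1 / 4) * ((1 + Real.exp (-2 * s)) / (1 - Real.exp (-2 * s)) * ‖x - y‖ ^ 2 +
      (1 - Real.exp (-2 * s)) / (1 + Real.exp (-2 * s)) * ‖x + y‖ ^ 2))

/-- A_{j,s}(x,y) = (∂_{x_j} + x_j) W_s(x,y). -/
noncomputable def A (n : ℕ) (j : Fin n) (s : ℝ) (x y : EuclideanSpace ℝ (Fin n)) : ℝ :=
  (x j - 1 / 2 * ((1 + Real.exp (-2 * s)) / (1 - Real.exp (-2 * s))) * (x j - y j) -
    1 / 2 * ((1 - Real.exp (-2 * s)) / (1 + Real.exp (-2 * s))) * (x j + y j)) * W n s x y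

/-- Ω_j(x,y,t) = t (∂_{x_j} + x_j) P_t^L(x,y), where P_t^L is the Hermite-Poisson kernel. -/
noncomputable def Omj (n : ℕ) (j : Fin n) (x y : EuclideanSpace ℝ (Fin n)) (t : ℝ) : ℝ :=
  t ^ 2 / Real.sqrt (4 * Real.pi) *
    ∫ s in Set.Ioi (0 : ℝ), s ^ (-(3 : ℝ) / 2) * Real.exp (-t ^ 2 / (4 * s)) * A n j s x y

/-- An elementary Gaussian bound. -/
theorem mul_exp_neg_sq_div_le (u : ℝ) : u * exp (-(u ^ 2 / 16)) ≤ 4 := by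
  have h : u ≤ 4 * exp (u ^ 2 / 16) := by
    nlinarith [add_one_le_exp (u ^ 2 / 16), sq_nonneg (u / 2 - 1)]
  rw [exp_neg, ← div_eq_mul_inv]
  exact (div_le_iff₀ (exp_pos _)).2 h

theorem inv_rpow_comp_exp_eq (a b : ℝ) {s : ℝ} (hs : s ∈ Ioi (0 : ℝ)) :
    (|(-1 : ℝ)| * s ^ ((-1 : ℝ) - 1)) • ((s ^ (-1 : ℝ)) ^ (a - 1) * exp (-(b * s ^ (-1 : ℝ)))) =
      s ^ (-a - 1) * exp (-(b / s)) := by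
  have hs : 0 < s := hs
  rw [smul_eq_mul, abs_neg, abs_one, one_mul, ← rpow_mul hs.le, ← mul_assoc, ← rpow_add hs,
    rpow_neg_one, ← div_eq_mul_inv]
  congr 2
  ring

theorem integral_rpow_mul_exp_neg_div_Ioi {a b : ℝ} (ha : 0 < a) (hb : 0 < b) :
    ∫ s in Ioi (0 : ℝ), s ^ (-a - 1) * exp (-(b / s)) = (1 / b) ^ a * Gamma a := by
  rw [← integral_rpow_mul_exp_neg_mul_Ioi ha hb, ← integral_comp_rpow_Ioi
    (fun u => u ^ (a - 1) * exp (-(b * u))) (p := -1) (by norm_num)]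
  exact setIntegral_congr_fun measurableSet_Ioi fun s hs => (inv_rpow_comp_exp_eq a b hs).symm

theorem integrableOn_rpow_mul_exp_neg_div_Ioi {a b : ℝ} (ha : 0 < a) (hb : 0 < b) :
    IntegrableOn (fun s : ℝ => s ^ (-a - 1) * exp (-(b / s))) (Ioi 0) := by
  have h : IntegrableOn (fun u : ℝ => u ^ (a - 1) * exp (-(b * u))) (Ioi 0) := by
    have := integrableOn_rpow_mul_exp_neg_mul_rpow (p := 1) (s := a - 1) (b := b)
      (by linarith) (by norm_num) hb
    simpa using this
  rw [← integrableOn_Ioi_comp_rpow_iff _ (p := -1) (by norm_num)] at h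
  exact h.congr_fun (fun s hs => inv_rpow_comp_exp_eq a b hs) measurableSet_Ioi

theorem integral_mul_inv_sq_add_pow (n : ℕ) (hn : 1 ≤ n) {d : ℝ} (hd : 0 < d) :
    IntegrableOn (fun t : ℝ => t * ((t ^ 2 / 4 + d) ^ (n + 1))⁻¹) (Ioi 0) ∧
      ∫ t in Ioi (0 : ℝ), t * ((t ^ 2 / 4 + d) ^ (n + 1))⁻¹ = 2 / n * (d ^ n)⁻¹ := by
  have hn0 : (n : ℝ) ≠ 0 := by positivity
  have hderiv : ∀ t ∈ Ici (0 : ℝ),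
      HasDerivAt (fun t : ℝ => -(2 / n : ℝ) * ((t ^ 2 / 4 + d) ^ n)⁻¹)
      (t * ((t ^ 2 / 4 + d) ^ (n + 1))⁻¹) t := by
    intro t _
    have hpos : 0 < t ^ 2 / 4 + d := by positivity
    have h := (((hasDerivAt_pow 2 t).div_const 4).add_const d).fun_pow n
    have h2 := (h.fun_inv (by positivity)).const_mul (-(2 / n : ℝ))
    refine h2.congr_deriv ?_
    obtain ⟨m, rfl⟩ : ∃ m, n = m + 1 := ⟨n - 1, by omega⟩
    simp only [Nat.add_sub_cancel]
    field_simp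
    ring
  have hnonneg : ∀ t ∈ Ioi (0 : ℝ), 0 ≤ t * ((t ^ 2 / 4 + d) ^ (n + 1))⁻¹ := by
    intro t ht
    have : 0 < t := ht
    positivity
  have hlim : Filter.Tendsto (fun t : ℝ => -(2 / n : ℝ) * ((t ^ 2 / 4 + d) ^ n)⁻¹)
      Filter.atTop (nhds 0) := by
    rw [← mul_zero (-(2 / n : ℝ))]
    refine Filter.Tendsto.const_mul _ (Filter.Tendsto.inv_tendsto_atTop ?_)
    refine (Filter.tendsto_pow_atTop (by omega)).comp ?_
    refine Filter.tendsto_atTop_add_const_right _ _ ?_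
    exact (Filter.tendsto_pow_atTop (by norm_num)).atTop_div_const (by norm_num)
  refine ⟨integrableOn_Ioi_deriv_of_nonneg' hderiv hnonneg hlim, ?_⟩
  rw [integral_Ioi_of_hasDerivAt_of_nonneg' hderiv hnonneg hlim]
  simp

theorem abs_coord_le_norm {n : ℕ} (z : EuclideanSpace ℝ (Fin n)) (j : Fin n) : |z j| ≤ ‖z‖ :=
  PiLp.norm_apply_le z j

/-- Gaussian bound for a linear factor, with half of the decay in the first variable retained. -/
theorem add_mul_exp_neg_le (u v : ℝ) :
    (u + v) * exp (-((u ^ 2 + v ^ 2) / 8)) ≤ 8 * exp (-(u ^ 2 / 16)) := by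
  have hsplit : exp (-((u ^ 2 + v ^ 2) / 8)) =
      exp (-(u ^ 2 / 16)) * (exp (-(u ^ 2 / 16)) * exp (-(v ^ 2 / 8))) := by
    rw [← exp_add, ← exp_add]
    ring_nf
  have hu : u * (exp (-(u ^ 2 / 16)) * exp (-(v ^ 2 / 8))) ≤ 4 := by
    rw [← mul_assoc]
    have h1 : exp (-(v ^ 2 / 8)) ≤ 1 := exp_le_one_iff.2 (by nlinarith [sq_nonneg v])
    nlinarith [mul_exp_neg_sq_div_le u, exp_pos (-(v ^ 2 / 8))]
  have hv : v * (exp (-(u ^ 2 / 16)) * exp (-(v ^ 2 / 8))) ≤ 4 := by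
    have h1 : exp (-(u ^ 2 / 16)) * exp (-(v ^ 2 / 16)) ≤ 1 := by
      rw [← exp_add]
      exact exp_le_one_iff.2 (by nlinarith [sq_nonneg v, sq_nonneg u])
    have h2 : exp (-(v ^ 2 / 8)) = exp (-(v ^ 2 / 16)) * exp (-(v ^ 2 / 16)) := by
      rw [← exp_add]
      ring_nf
    calc v * (exp (-(u ^ 2 / 16)) * exp (-(v ^ 2 / 8)))
        = (v * exp (-(v ^ 2 / 16))) * (exp (-(u ^ 2 / 16)) * exp (-(v ^ 2 / 16))) := by
          rw [h2]; ring
      _ ≤ 4 := by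
          nlinarith [mul_exp_neg_sq_div_le v,
            mul_pos (exp_pos (-(u ^ 2 / 16))) (exp_pos (-(v ^ 2 / 16)))]
  calc (u + v) * exp (-((u ^ 2 + v ^ 2) / 8))
      = exp (-(u ^ 2 / 16)) * (u * (exp (-(u ^ 2 / 16)) * exp (-(v ^ 2 / 8))) +
          v * (exp (-(u ^ 2 / 16)) * exp (-(v ^ 2 / 8)))) := by rw [hsplit]; ring
    _ ≤ exp (-(u ^ 2 / 16)) * (4 + 4) := by gcongr
    _ = 8 * exp (-(u ^ 2 / 16)) := by ring

/-- The parameter `τ = (1 - e^{-2s}) / (1 + e^{-2s})` lies in `(0, 1)`, is at most `2s`, and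
satisfies `(1 - τ) / τ ≤ 1 / s`. -/
theorem mehler_parameter_bounds {s : ℝ} (hs : 0 < s) :
    0 < (1 - exp (-2 * s)) / (1 + exp (-2 * s)) ∧
    (1 - exp (-2 * s)) / (1 + exp (-2 * s)) < 1 ∧
    (1 - exp (-2 * s)) / (1 + exp (-2 * s)) ≤ 2 * s ∧
    (1 - (1 - exp (-2 * s)) / (1 + exp (-2 * s))) * s ≤
      (1 - exp (-2 * s)) / (1 + exp (-2 * s)) := by
  have he : 0 < exp (-2 * s) := exp_pos _
  have he1 : exp (-2 * s) < 1 := exp_lt_one_iff.2 (by linarith)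
  have hadd := add_one_le_exp (-2 * s)
  have hadd' := add_one_le_exp (2 * s)
  have hmul : exp (-2 * s) * exp (2 * s) = 1 := by rw [← exp_add]; simp
  have hpos : 0 < 1 + exp (-2 * s) := by linarith
  refine ⟨div_pos (by linarith) hpos, (div_lt_one hpos).2 (by linarith),
    (div_le_iff₀ hpos).2 (by nlinarith), ?_⟩
  rw [one_sub_div hpos.ne', div_mul_eq_mul_div]
  gcongr
  nlinarith

theorem mehler_prefactor_le (n : ℕ) {s : ℝ} (hs : 0 < s) :
    (exp (-2 * s) / (π * (1 - exp (-4 * s)))) ^ ((n : ℝ) / 2) ≤ s ^ (-((n : ℝ) / 2)) := by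
  have he : 0 < exp (-2 * s) := exp_pos _
  have he1 : exp (-2 * s) < 1 := exp_lt_one_iff.2 (by linarith)
  have h4 : exp (-4 * s) = exp (-2 * s) ^ 2 := by rw [← exp_nat_mul]; ring_nf
  have hadd' := add_one_le_exp (2 * s)
  have hmul : exp (-2 * s) * exp (2 * s) = 1 := by rw [← exp_add]; simp
  have hpos : 0 < 1 - exp (-2 * s) ^ 2 := by nlinarith
  rw [rpow_neg hs.le, ← inv_rpow hs.le, h4]
  have hle : exp (-2 * s) / (π * (1 - exp (-2 * s) ^ 2)) ≤ s⁻¹ := by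
    rw [inv_eq_one_div, div_le_div_iff₀ (by positivity) hs]
    have h1 : exp (-2 * s) * s ≤ 1 - exp (-2 * s) ^ 2 := by nlinarith
    nlinarith [pi_gt_three]
  exact rpow_le_rpow (by positivity) hle (by positivity)

/-- The exponent of the Mehler kernel dominates `|x - y|² + |y| |x - y|`. -/
theorem norm_sub_sq_add_le {E : Type*} [NormedAddCommGroup E] [NormedSpace ℝ E] (x y : E) {τ : ℝ}
    (h0 : 0 < τ) (h1 : τ < 1) :
    ‖x - y‖ ^ 2 + ‖y‖ * ‖x - y‖ ≤ 2 * (1 / τ * ‖x - y‖ ^ 2 + τ * ‖x + y‖ ^ 2) := by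
  have hy : 2 * ‖y‖ ≤ ‖x + y‖ + ‖x - y‖ := by
    have h : (2 : ℝ) • y = (x + y) - (x - y) := by rw [two_smul]; abel
    calc 2 * ‖y‖ = ‖(2 : ℝ) • y‖ := by rw [norm_smul]; norm_num
      _ ≤ ‖x + y‖ + ‖x - y‖ := h ▸ norm_sub_le _ _
  have hr : 0 ≤ ‖x - y‖ := norm_nonneg _
  have hle : ‖x - y‖ ^ 2 ≤ 1 / τ * ‖x - y‖ ^ 2 :=
    le_mul_of_one_le_left (by positivity) ((one_le_div h0).2 h1.le)
  have hamgm : 2 * (‖x - y‖ * ‖x + y‖) ≤ 1 / τ * ‖x - y‖ ^ 2 + τ * ‖x + y‖ ^ 2 := by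
    have h : 1 / τ * ‖x - y‖ ^ 2 + τ * ‖x + y‖ ^ 2 - 2 * (‖x - y‖ * ‖x + y‖) =
        1 / τ * (‖x - y‖ - τ * ‖x + y‖) ^ 2 := by
      field_simp
      ring
    have : 0 ≤ 1 / τ * (‖x - y‖ - τ * ‖x + y‖) ^ 2 := by positivity
    linarith
  have hq : 0 ≤ τ * ‖x + y‖ ^ 2 := by positivity
  nlinarith

theorem abs_A_le (n : ℕ) (j : Fin n) (x y : EuclideanSpace ℝ (Fin n)) {s : ℝ} (hs : 0 < s) :
    |A n j s x y| ≤ 4 * exp (-(1 / 16) * (‖x - y‖ ^ 2 + ‖y‖ * ‖x - y‖)) *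
      (s ^ (-(1 : ℝ) / 2 - n / 2) * exp (-(‖x - y‖ ^ 2 / 32 / s))) := by
  obtain ⟨h0, h1, h2, h3⟩ := mehler_parameter_bounds hs
  have hpre := mehler_prefactor_le n hs
  have hpre0 : 0 ≤ (exp (-2 * s) / (π * (1 - exp (-4 * s)))) ^ ((n : ℝ) / 2) := by
    have : exp (-4 * s) < 1 := exp_lt_one_iff.2 (by linarith)
    have : 0 < 1 - exp (-4 * s) := by linarith
    positivity
  unfold A W
  rw [← one_div_div (1 - exp (-2 * s)) (1 + exp (-2 * s))]
  set τ := (1 - exp (-2 * s)) / (1 + exp (-2 * s))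
  set D := (exp (-2 * s) / (π * (1 - exp (-4 * s)))) ^ ((n : ℝ) / 2)
  set r := ‖x - y‖
  set q := ‖x + y‖
  have hr0 : 0 ≤ r := norm_nonneg _
  have hq0 : 0 ≤ q := norm_nonneg _
  have hk : 0 < √τ := sqrt_pos.2 h0
  have hkk : √τ ^ 2 = τ := sq_sqrt h0.le
  have hexp : exp (-(1 / 4) * (1 / τ * r ^ 2 + τ * q ^ 2)) ≤
      exp (-(1 / 16) * (r ^ 2 + ‖y‖ * r)) * exp (-(((r / √τ) ^ 2 + (√τ * q) ^ 2) / 8)) := by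
    rw [← exp_add, div_pow, mul_pow, hkk]
    refine exp_le_exp.2 ?_
    have h := norm_sub_sq_add_le x y h0 h1
    have h' : r ^ 2 / τ = 1 / τ * r ^ 2 := by ring
    rw [h']
    linarith
  have hcoef : |x j - 1 / 2 * (1 / τ) * (x j - y j) - 1 / 2 * τ * (x j + y j)| ≤
      1 / 2 * ((1 - τ) / √τ) * (r / √τ + √τ * q) := by
    have hrj : |x j - y j| ≤ r := abs_coord_le_norm (x - y) j
    have hqj : |x j + y j| ≤ q := abs_coord_le_norm (x + y) j
    have hτ1 : 0 ≤ 1 - τ := by linarith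
    calc |x j - 1 / 2 * (1 / τ) * (x j - y j) - 1 / 2 * τ * (x j + y j)|
        = |1 / 2 * (1 - τ) * (x j + y j) - 1 / 2 * ((1 - τ) / τ) * (x j - y j)| := by
          congr 1
          field_simp
          ring
      _ ≤ |1 / 2 * (1 - τ) * (x j + y j)| + |1 / 2 * ((1 - τ) / τ) * (x j - y j)| := abs_sub _ _
      _ = 1 / 2 * (1 - τ) * |x j + y j| + 1 / 2 * ((1 - τ) / τ) * |x j - y j| := by
          rw [abs_mul, abs_mul (1 / 2 * ((1 - τ) / τ)), abs_of_nonneg (by positivity),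
            abs_of_nonneg (a := 1 / 2 * ((1 - τ) / τ)) (by positivity)]
      _ ≤ 1 / 2 * (1 - τ) * q + 1 / 2 * ((1 - τ) / τ) * r := by gcongr
      _ = 1 / 2 * ((1 - τ) / √τ) * (r / √τ + √τ * q) := by
          have h : ∀ k : ℝ, 0 < k → 1 / 2 * (1 - k ^ 2) * q + 1 / 2 * ((1 - k ^ 2) / k ^ 2) * r =
              1 / 2 * ((1 - k ^ 2) / k) * (r / k + k * q) := by
            intro k hk
            field_simp
            ring
          simpa only [hkk] using h (√τ) hk
  have hratio : (1 - τ) / √τ ≤ s ^ (-(1 : ℝ) / 2) := by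
    rw [neg_div, rpow_neg hs.le, ← sqrt_eq_rpow, div_le_iff₀ hk, ← div_eq_inv_mul,
      le_div_iff₀ (sqrt_pos.2 hs)]
    refine le_sqrt_of_sq_le ?_
    rw [mul_pow, sq_sqrt hs.le]
    nlinarith
  have hgauss : exp (-((r / √τ) ^ 2 / 16)) ≤ exp (-(r ^ 2 / 32 / s)) := by
    rw [div_pow, hkk, div_div, div_div]
    refine exp_le_exp.2 (neg_le_neg ?_)
    exact div_le_div_of_nonneg_left (by positivity) (by positivity) (by linarith)
  have hτ1 : 0 ≤ 1 - τ := by linarith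
  rw [abs_mul, abs_of_nonneg (a := D * _) (by positivity)]
  set F := exp (-(1 / 16) * (r ^ 2 + ‖y‖ * r))
  calc _ ≤ (1 / 2 * ((1 - τ) / √τ) * (r / √τ + √τ * q)) *
        (D * (F * exp (-(((r / √τ) ^ 2 + (√τ * q) ^ 2) / 8)))) := by gcongr
    _ = 1 / 2 * F * (((1 - τ) / √τ) * D) *
        ((r / √τ + √τ * q) * exp (-(((r / √τ) ^ 2 + (√τ * q) ^ 2) / 8))) := by ring
    _ ≤ 1 / 2 * F * (s ^ (-(1 : ℝ) / 2) * s ^ (-((n : ℝ) / 2))) *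
        (8 * exp (-(r ^ 2 / 32 / s))) := by
        gcongr ?_ * ?_
        · gcongr
        · exact (add_mul_exp_neg_le _ _).trans (by gcongr)
    _ = _ := by
        rw [← rpow_add hs, ← sub_eq_add_neg]
        ring

theorem abs_Omj_le (n : ℕ) (j : Fin n) {x y : EuclideanSpace ℝ (Fin n)} (hxy : x ≠ y) (t : ℝ) :
    |Omj n j x y t| ≤ 4 * exp (-(1 / 16) * (‖x - y‖ ^ 2 + ‖y‖ * ‖x - y‖)) * Gamma (n / 2 + 1) *
      (t ^ 2 * (1 / (t ^ 2 / 4 + ‖x - y‖ ^ 2 / 32)) ^ ((n : ℝ) / 2 + 1)) := by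
  have hr : 0 < ‖x - y‖ := norm_pos_iff.2 (sub_ne_zero.2 hxy)
  have ha : (0 : ℝ) < n / 2 + 1 := by positivity
  have hb : 0 < t ^ 2 / 4 + ‖x - y‖ ^ 2 / 32 := by positivity
  set F := exp (-(1 / 16) * (‖x - y‖ ^ 2 + ‖y‖ * ‖x - y‖))
  have hint := (integrableOn_rpow_mul_exp_neg_div_Ioi ha hb).const_mul (4 * F)
  have hbound : ∀ᵐ s ∂(volume.restrict (Ioi (0 : ℝ))),
      ‖s ^ (-(3 : ℝ) / 2) * exp (-t ^ 2 / (4 * s)) * A n j s x y‖ ≤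
        4 * F * (s ^ (-((n : ℝ) / 2 + 1) - 1) *
          exp (-((t ^ 2 / 4 + ‖x - y‖ ^ 2 / 32) / s))) := by
    refine (ae_restrict_iff' measurableSet_Ioi).2 (ae_of_all _ fun s hs => ?_)
    have hs : 0 < s := hs
    rw [norm_mul, norm_eq_abs, norm_eq_abs, abs_of_nonneg (by positivity)]
    calc _ ≤ s ^ (-(3 : ℝ) / 2) * exp (-t ^ 2 / (4 * s)) *
          (4 * F * (s ^ (-(1 : ℝ) / 2 - n / 2) * exp (-(‖x - y‖ ^ 2 / 32 / s)))) := by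
          gcongr
          exact abs_A_le n j x y hs
      _ = 4 * F * ((s ^ (-(3 : ℝ) / 2) * s ^ (-(1 : ℝ) / 2 - n / 2)) *
          (exp (-t ^ 2 / (4 * s)) * exp (-(‖x - y‖ ^ 2 / 32 / s)))) := by ring
      _ = _ := by
          rw [← rpow_add hs, ← exp_add]
          congr 3
          · ring
          · field_simp
            ring
  have hle := norm_integral_le_of_norm_le hint hbound
  rw [integral_const_mul, integral_rpow_mul_exp_neg_div_Ioi ha hb, norm_eq_abs] at hle
  have hpi : 1 ≤ √(4 * π) := one_le_sqrt.2 (by linarith [pi_gt_three])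
  unfold Omj
  rw [abs_mul, abs_of_nonneg (by positivity)]
  calc _ ≤ t ^ 2 * (4 * F * ((1 / (t ^ 2 / 4 + ‖x - y‖ ^ 2 / 32)) ^ ((n : ℝ) / 2 + 1) *
        Gamma (n / 2 + 1))) := by
        gcongr
        exact div_le_self (by positivity) hpi
    _ = _ := by ring

theorem Omj_H_norm_bound (n : ℕ) (hn : 1 ≤ n) (j : Fin n) :
    ∃ C > (0 : ℝ), ∃ c > (0 : ℝ), ∀ x y : EuclideanSpace ℝ (Fin n), x ≠ y →
      Real.sqrt (∫ t in Set.Ioi (0 : ℝ), Omj n j x y t ^ 2 / t) ≤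
        C * Real.exp (-c * (‖x - y‖ ^ 2 + ‖y‖ * ‖x - y‖)) / ‖x - y‖ ^ n := by
  have hG : 0 < Gamma ((n : ℝ) / 2 + 1) := Gamma_pos_of_pos (by positivity)
  refine ⟨16 * Gamma ((n : ℝ) / 2 + 1) * 6 ^ n, by positivity, 1 / 16, by norm_num, ?_⟩
  intro x y hxy
  have hr : 0 < ‖x - y‖ := norm_pos_iff.2 (sub_ne_zero.2 hxy)
  have hd : 0 < ‖x - y‖ ^ 2 / 32 := by positivity
  have hOm := abs_Omj_le n j hxy
  set G := Gamma ((n : ℝ) / 2 + 1)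
  set F := exp (-(1 / 16) * (‖x - y‖ ^ 2 + ‖y‖ * ‖x - y‖))
  have hF : 0 < F := exp_pos _
  obtain ⟨hint, hval⟩ := integral_mul_inv_sq_add_pow n hn hd
  have hle : ∫ t in Ioi (0 : ℝ), Omj n j x y t ^ 2 / t ≤ ∫ t in Ioi (0 : ℝ),
      64 * F ^ 2 * G ^ 2 * (t * ((t ^ 2 / 4 + ‖x - y‖ ^ 2 / 32) ^ (n + 1))⁻¹) := by
    refine integral_mono_of_nonneg ?_ (hint.const_mul _) ?_
    · refine (ae_restrict_iff' measurableSet_Ioi).2 (ae_of_all _ fun t ht => ?_)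
      have ht : 0 < t := ht
      exact div_nonneg (sq_nonneg _) ht.le
    · refine (ae_restrict_iff' measurableSet_Ioi).2 (ae_of_all _ fun t ht => ?_)
      have ht : 0 < t := ht
      have hb : 0 < t ^ 2 / 4 + ‖x - y‖ ^ 2 / 32 := by positivity
      have hsq := pow_le_pow_left₀ (abs_nonneg _) (hOm t) 2
      have hbt : t ^ 2 ≤ 4 * (t ^ 2 / 4 + ‖x - y‖ ^ 2 / 32) := by linarith
      set b := t ^ 2 / 4 + ‖x - y‖ ^ 2 / 32
      have hpow : ((1 / b) ^ ((n : ℝ) / 2 + 1)) ^ 2 = (b ^ (n + 2))⁻¹ := by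
        rw [← rpow_natCast, ← rpow_mul (by positivity), ← inv_pow, ← rpow_natCast, one_div]
        congr 1
        push_cast
        ring
      rw [sq_abs, mul_pow, mul_pow (t ^ 2), hpow] at hsq
      show Omj n j x y t ^ 2 / t ≤ 64 * F ^ 2 * G ^ 2 * (t * (b ^ (n + 1))⁻¹)
      rw [div_le_iff₀ ht]
      calc _ ≤ _ := hsq
        _ = 16 * F ^ 2 * G ^ 2 * (t ^ 2 * (t ^ 2 * (b ^ (n + 2))⁻¹)) := by ring
        _ ≤ 16 * F ^ 2 * G ^ 2 * (t ^ 2 * ((4 * b) * (b ^ (n + 2))⁻¹)) := by gcongr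
        _ = _ := by
          field_simp
          ring
  rw [integral_const_mul, hval] at hle
  refine sqrt_le_iff.2 ⟨by positivity, hle.trans ?_⟩
  have hn' : (2 : ℝ) / n ≤ 4 := by
    have : (1 : ℝ) ≤ n := by exact_mod_cast hn
    rw [div_le_iff₀ (by positivity)]
    linarith
  have hpow : ((‖x - y‖ ^ 2 / 32) ^ n)⁻¹ ≤ (6 ^ n / ‖x - y‖ ^ n) ^ 2 := by
    rw [← inv_pow, ← div_pow, ← pow_mul, mul_comm n 2, pow_mul, inv_div, div_pow 6]
    gcongr
    norm_num
  calc _ ≤ 64 * F ^ 2 * G ^ 2 * (4 * (6 ^ n / ‖x - y‖ ^ n) ^ 2) := by gcongr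
    _ = _ := by ring
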